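/- If every rule of a rule set 𝓡 has an atomic head and every fair R-derivation from the knowledge base ⟨𝓡,F⟩ is finite, then there exists a natural number k such that every R-derivation (fair or not) from ⟨𝓡,F⟩ has length at most k; consequently, for any fixed factbase F, the set of (codes of) finite atomic-head rule sets 𝓡 such that every fair R-derivation from ⟨𝓡,F⟩ is finite is computably enumerable. -/

import Mathlib

namespace ExRules

open scoped Classical

noncomputable section

/-- Terms: constants or variables, each indexed by a natural number. -/
inductive Term where
  | const : ℕ → Term
  | var : ℕ → Term
deriving DecidableEq

/-- An atom: a predicate symbol applied to a list of terms (the arity of the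
predicate is the length of the argument list). -/
structure Atom where
  pred : ℕ
  args : List Term
deriving DecidableEq

/-- A factbase is a finite set of atoms. -/
abbrev FactBase := Finset Atom

/-- A substitution: a map on variables (extended by the identity on constants). -/
abbrev Subst := ℕ → Term

def applyTerm (σ : Subst) : Term → Term
  | .const c => .const c
  | .var v => σ v

def Atom.subst (σ : Subst) (a : Atom) : Atom := ⟨a.pred, a.args.map (applyTerm σ)⟩

def Term.vars : Term → Finset ℕ
  | .const _ => ∅
  | .var v => {v}

def Atom.vars (a : Atom) : Finset ℕ := a.args.foldr (fun t s => t.vars ∪ s) ∅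

def FactBase.vars (F : FactBase) : Finset ℕ := F.sup Atom.vars

/-- The variables occurring in a (possibly infinite) set of atoms. -/
def setVars (S : Set Atom) : Set ℕ := {v | ∃ a ∈ S, v ∈ a.vars}

/-- `σ` is a homomorphism from the atom set `S` to the atom set `S'`. -/
def IsHom (σ : Subst) (S S' : Set Atom) : Prop := ∀ a ∈ S, a.subst σ ∈ S'

/-- A retraction is a homomorphism that is the identity on the common variables. -/
def IsRetraction (σ : Subst) (S S' : Set Atom) : Prop :=
  IsHom σ S S' ∧ ∀ v, v ∈ setVars S → v ∈ setVars S' → σ v = Term.var v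

/-- An existential rule `B → ∃z.H` with nonempty body and head.  The frontier and
the existential variables are determined by the variables shared between body and
head. -/
structure Rule where
  body : Finset Atom
  head : Finset Atom
  body_nonempty : body.Nonempty
  head_nonempty : head.Nonempty

instance : DecidableEq Rule := fun R S =>
  decidable_of_iff (R.body = S.body ∧ R.head = S.head) (by
    constructor
    · rintro ⟨h1, h2⟩
      cases R; cases S; simp_all
    · rintro rfl; exact ⟨rfl, rfl⟩)

/-- The frontier of a rule: the variables shared by body and head. -/
def Rule.frontier (R : Rule) : Finset ℕ := FactBase.vars R.body ∩ FactBase.vars R.head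

/-- The existential variables of a rule: head variables not occurring in the body. -/
def Rule.exVars (R : Rule) : Finset ℕ := FactBase.vars R.head \ FactBase.vars R.body

/-- A rule is Datalog if it has no existential variable. -/
def Rule.IsDatalog (R : Rule) : Prop := R.exVars = ∅

/-- A rule has an atomic head if its head is a single atom. -/
def Rule.IsAtomicHead (R : Rule) : Prop := R.head.card = 1

/-- A rule set is a finite set of existential rules. -/
abbrev RuleSet := Finset Rule

instance : Encodable Term :=
  Encodable.ofEquiv (ℕ ⊕ ℕ)
    { toFun := fun t => match t with | .const c => .inl c | .var v => .inr v
      invFun := fun s => match s with | .inl c => .const c | .inr v => .var v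
      left_inv := by intro t; cases t <;> rfl
      right_inv := by intro s; cases s <;> rfl }

instance : Encodable Atom :=
  Encodable.ofEquiv (ℕ × List Term)
    { toFun := fun a => (a.pred, a.args)
      invFun := fun p => ⟨p.1, p.2⟩
      left_inv := fun _ => rfl
      right_inv := fun _ => rfl }

instance : Encodable Rule :=
  Encodable.ofEquiv {p : Finset Atom × Finset Atom // p.1.Nonempty ∧ p.2.Nonempty}
    { toFun := fun R => ⟨(R.body, R.head), R.body_nonempty, R.head_nonempty⟩
      invFun := fun p => ⟨p.1.1, p.1.2, p.2.1, p.2.2⟩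
      left_inv := fun _ => rfl
      right_inv := fun _ => rfl }

/-- A trigger `(R, π)`: a rule together with a substitution. -/
structure Trigger where
  rule : Rule
  map : Subst

/-- The canonical fresh variable `z_t` associated to a trigger `t` and an
existential variable `z`: it is unique for `z` and (the relevant part of) `t`. -/
def Trigger.freshVar (t : Trigger) (z : ℕ) : ℕ :=
  Nat.pair
    (Encodable.encode (t.rule, ((FactBase.vars t.rule.body).sort (· ≤ ·)).map t.map)) z

/-- The extension `π_R` of the substitution of a trigger, mapping each existential
variable `z` to the fresh variable `z_t`. -/
def Trigger.ext (t : Trigger) : Subst := fun v =>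
  if v ∈ t.rule.exVars then Term.var (t.freshVar v) else t.map v

/-- The output of a trigger: `out(t) = π_R(H)`. -/
def Trigger.out (t : Trigger) : Finset Atom := t.rule.head.image (Atom.subst t.ext)

/-- `t` is a trigger on the factbase `F`: its substitution is a homomorphism from
the body of its rule to `F`. -/
def Trigger.IsOn (t : Trigger) (F : FactBase) : Prop := IsHom t.map ↑t.rule.body ↑F

/-- The chase variants: oblivious, semi-oblivious, restricted, equivalent. -/
inductive Variant where
  | O | SO | R | E

/-- Applicability of a trigger on a factbase, for each chase variant. -/
def Applicable : Variant → Trigger → FactBase → Prop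
  | .O, t, F => ¬ t.out ⊆ F
  | .SO, t, F => ∀ t' : Trigger, t'.rule = t.rule →
      (∀ v ∈ t.rule.frontier, t'.map v = t.map v) → ¬ t'.out ⊆ F
  | .R, t, F => ¬ ∃ σ : Subst, IsRetraction σ ↑(F ∪ t.out) ↑F
  | .E, t, F => ¬ ∃ σ : Subst, IsHom σ ↑(F ∪ t.out) ↑F

/-- An atom set `M` satisfies a rule `B → ∃z.H` if every homomorphism from `B`
to `M` extends to a homomorphism mapping `H` into `M`. -/
def SatisfiesRule (M : Set Atom) (R : Rule) : Prop :=
  ∀ σ : Subst, IsHom σ ↑R.body M →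
    ∃ σ' : Subst, (∀ v ∈ FactBase.vars R.body, σ' v = σ v) ∧ IsHom σ' ↑R.head M

/-- A (finite or infinite) derivation from the knowledge base `⟨𝓡, F⟩`:
`len` is the number of triggers (possibly `⊤`), `fb i` is the `i`-th factbase and,
for `i < len`, `tr i` is the trigger producing `fb (i+1)` from `fb i`. -/
structure Derivation (𝓡 : RuleSet) (F : FactBase) where
  len : ℕ∞
  fb : ℕ → FactBase
  tr : ℕ → Trigger
  fb_zero : fb 0 = F
  rule_mem : ∀ i : ℕ, (i : ℕ∞) < len → (tr i).rule ∈ 𝓡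
  trig_on : ∀ i : ℕ, (i : ℕ∞) < len → (tr i).IsOn (fb i)
  trig_new : ∀ i : ℕ, (i : ℕ∞) < len → ¬ (tr i).out ⊆ fb i
  fb_succ : ∀ i : ℕ, (i : ℕ∞) < len → fb (i + 1) = fb i ∪ (tr i).out
  fb_stall : ∀ i : ℕ, ¬ (i : ℕ∞) < len → fb (i + 1) = fb i

namespace Derivation

variable {𝓡 : RuleSet} {F : FactBase}

/-- An `X`-derivation: every applied trigger is `X`-applicable when applied. -/
def IsX (X : Variant) (D : Derivation 𝓡 F) : Prop :=
  ∀ i : ℕ, (i : ℕ∞) < D.len → Applicable X (D.tr i) (D.fb i)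

/-- Datalog-first: a non-Datalog rule is only applied when all Datalog rules of
the rule set are satisfied. -/
def DatalogFirst (D : Derivation 𝓡 F) : Prop :=
  ∀ i : ℕ, (i : ℕ∞) < D.len → ¬ (D.tr i).rule.IsDatalog →
    ∀ R ∈ 𝓡, R.IsDatalog → SatisfiesRule ↑(D.fb i) R

/-- Fairness: every trigger `X`-applicable on some factbase of the derivation is
eventually not `X`-applicable. -/
def Fair (X : Variant) (D : Derivation 𝓡 F) : Prop :=
  ∀ i : ℕ, (i : ℕ∞) ≤ D.len → ∀ t : Trigger, t.rule ∈ 𝓡 → t.IsOn (D.fb i) →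
    Applicable X t (D.fb i) →
    ∃ j : ℕ, i < j ∧ (j : ℕ∞) ≤ D.len ∧ ¬ Applicable X t (D.fb j)

/-- A derivation is finite if its length is not `⊤`. -/
def Finite (D : Derivation 𝓡 F) : Prop := D.len ≠ ⊤

end Derivation

/-- `CT_X^∀` (non-Datalog-first): every fair `X`-derivation from every KB is finite. -/
def CTall (X : Variant) (𝓡 : RuleSet) : Prop :=
  ∀ F : FactBase, ∀ D : Derivation 𝓡 F, D.IsX X → D.Fair X → D.Finite

/-- `CT_X^∃`: some fair `X`-derivation from every KB is finite. -/
def CTex (X : Variant) (𝓡 : RuleSet) : Prop :=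
  ∀ F : FactBase, ∃ D : Derivation 𝓡 F, D.IsX X ∧ D.Fair X ∧ D.Finite

/-- `CT_{df-X}^∀`: every fair Datalog-first `X`-derivation from every KB is finite. -/
def CTallDF (X : Variant) (𝓡 : RuleSet) : Prop :=
  ∀ F : FactBase, ∀ D : Derivation 𝓡 F, D.IsX X → D.DatalogFirst → D.Fair X → D.Finite

/-- `CT_{df-X}^∃`: some fair Datalog-first `X`-derivation from every KB is finite. -/
def CTexDF (X : Variant) (𝓡 : RuleSet) : Prop :=
  ∀ F : FactBase, ∃ D : Derivation 𝓡 F, D.IsX X ∧ D.DatalogFirst ∧ D.Fair X ∧ D.Finite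

/-! ### Single-piece decomposition -/

/-- Adjacency in the piece graph of a rule: two head atoms sharing an existential
variable. -/
def PieceAdj (R : Rule) (a b : Atom) : Prop :=
  a ∈ R.head ∧ b ∈ R.head ∧ (a.vars ∩ b.vars ∩ R.exVars).Nonempty

/-- The piece (connected component of the piece graph) containing a given head atom. -/
def pieceOf (R : Rule) (a : Atom) : Finset Atom :=
  R.head.filter fun b => Relation.ReflTransGen (PieceAdj R) a b

theorem self_mem_pieceOf {R : Rule} {a : Atom} (h : a ∈ R.head) : a ∈ pieceOf R a := by
  rw [pieceOf, Finset.mem_filter]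
  exact ⟨h, Relation.ReflTransGen.refl⟩

/-- The single-piece decomposition of a rule. -/
def Rule.sp (R : Rule) : Finset Rule :=
  R.head.attach.image fun a =>
    ⟨R.body, pieceOf R a.1, R.body_nonempty, ⟨a.1, self_mem_pieceOf a.2⟩⟩

/-- The single-piece decomposition of a rule set. -/
def spSet (𝓡 : RuleSet) : RuleSet := 𝓡.biUnion Rule.sp

/-! ### Atomic decompositions -/

/-- The predicates occurring in a rule set. -/
def RuleSet.predsF (𝓡 : RuleSet) : Finset ℕ :=
  𝓡.sup fun R => (R.body.image Atom.pred) ∪ (R.head.image Atom.pred)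

/-- A fresh predicate `X_R`, unique for `R` and not occurring in `𝓡`. -/
def freshPred (𝓡 : RuleSet) (R : Rule) : ℕ :=
  (RuleSet.predsF 𝓡).sup id + 1 + Encodable.encode R

/-- The atom `X_R(x, z)` over the fresh predicate, whose arguments are the frontier
variables followed by the existential variables of `R`. -/
def xAtom (𝓡 : RuleSet) (R : Rule) : Atom :=
  ⟨freshPred 𝓡 R,
    ((R.frontier.sort (· ≤ ·)).map Term.var) ++ ((R.exVars.sort (· ≤ ·)).map Term.var)⟩

/-- The one-way atomic decomposition of a rule `R = B → ∃z.H` (relative to `𝓡`):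
the rule `B → ∃z.X_R(x,z)` together with a rule `X_R(x,z) → P(t)` for each head atom. -/
def oneAdRule (𝓡 : RuleSet) (R : Rule) : Finset Rule :=
  insert ⟨R.body, {xAtom 𝓡 R}, R.body_nonempty, Finset.singleton_nonempty _⟩
    (R.head.attach.image fun a =>
      ⟨{xAtom 𝓡 R}, {a.1}, Finset.singleton_nonempty _, Finset.singleton_nonempty _⟩)

/-- The one-way atomic decomposition of a rule set. -/
def oneAd (𝓡 : RuleSet) : RuleSet := 𝓡.biUnion (oneAdRule 𝓡)

/-- The two-way atomic decomposition: `2ad(R) = 1ad(R) ∪ {H[x,z] → X_R(x,z)}`. -/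
def twoAd (𝓡 : RuleSet) : RuleSet :=
  oneAd 𝓡 ∪ 𝓡.image fun R =>
    ⟨R.head, {xAtom 𝓡 R}, R.head_nonempty, Finset.singleton_nonempty _⟩

/-! ### Models, entailment, BDDP -/

/-- `M` is a model of the rule set `𝓡`. -/
def IsModelOfRules (𝓡 : RuleSet) (M : Set Atom) : Prop := ∀ R ∈ 𝓡, SatisfiesRule M R

/-- `M` is a model of the knowledge base `⟨𝓡, F⟩`. -/
def IsModelOfKB (𝓡 : RuleSet) (F : FactBase) (M : Set Atom) : Prop :=
  IsModelOfRules 𝓡 M ∧ ∃ σ : Subst, IsHom σ ↑F M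

/-- `M` is a universal model of `⟨𝓡, F⟩`: a model mapping homomorphically into
every model. -/
def IsUniversalModel (𝓡 : RuleSet) (F : FactBase) (M : Set Atom) : Prop :=
  IsModelOfKB 𝓡 F M ∧ ∀ N : Set Atom, IsModelOfKB 𝓡 F N → ∃ σ : Subst, IsHom σ M N

/-- An atom set entails a Boolean conjunctive query `Q` if `Q` maps
homomorphically into it. -/
def EntailsQ (S : Set Atom) (Q : Finset Atom) : Prop := ∃ σ : Subst, IsHom σ ↑Q S

/-- `⟨𝓡, F⟩ ⊨ Q`: every model of the KB entails `Q`. -/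
def KBEntails (𝓡 : RuleSet) (F : FactBase) (Q : Finset Atom) : Prop :=
  ∀ M : Set Atom, IsModelOfKB 𝓡 F M → EntailsQ M Q

/-- `R(F)`: the minimal atom set including `F` and `out(t)` for every trigger `t`
with rule `R` on `F`. -/
def ruleStep (R : Rule) (S : Set Atom) : Set Atom :=
  S ∪ {a | ∃ t : Trigger, t.rule = R ∧ IsHom t.map ↑R.body S ∧ a ∈ t.out}

/-- `𝓡(F) = ⋃_{R ∈ 𝓡} R(F)` (together with `F`). -/
def setStep (𝓡 : RuleSet) (S : Set Atom) : Set Atom := S ∪ ⋃ R ∈ 𝓡, ruleStep R S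

/-- The breadth-first chase `Ch_i(⟨𝓡, F⟩)`. -/
def ch (𝓡 : RuleSet) (F : FactBase) : ℕ → Set Atom
  | 0 => ↑F
  | i + 1 => setStep 𝓡 (ch 𝓡 F i)

/-- The bounded derivation depth property. -/
def BDDP (𝓡 : RuleSet) : Prop :=
  ∀ Q : Finset Atom, ∃ k : ℕ, ∀ F : FactBase, KBEntails 𝓡 F Q ↔ EntailsQ (ch 𝓡 F k) Q

/-! ### Conservative extensions -/

/-- The restriction of an atom set to the atoms over a given set of predicates. -/
def restrictTo (M : Set Atom) (P : Set ℕ) : Set Atom := {a ∈ M | a.pred ∈ P}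

/-- The terms (domain elements) of an atom set. -/
def termsOf (M : Set Atom) : Set Term := {u | ∃ a ∈ M, u ∈ a.args}

/-- `𝓡'` is a conservative extension of `𝓡`. -/
def ConservativeExt (𝓡 𝓡' : RuleSet) : Prop :=
  (↑(RuleSet.predsF 𝓡) : Set ℕ) ⊆ ↑(RuleSet.predsF 𝓡') ∧
  (∀ M : Set Atom, IsModelOfRules 𝓡' M →
    IsModelOfRules 𝓡 (restrictTo M ↑(RuleSet.predsF 𝓡))) ∧
  (∀ M : Set Atom, IsModelOfRules 𝓡 M →
    ∃ M' : Set Atom, M ⊆ M' ∧ IsModelOfRules 𝓡' M' ∧ termsOf M' = termsOf M ∧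
      restrictTo M' ↑(RuleSet.predsF 𝓡) = restrictTo M ↑(RuleSet.predsF 𝓡))

/-- `𝓡'` is a universal-conservative extension of `𝓡`. -/
def UnivConservativeExt (𝓡 𝓡' : RuleSet) : Prop :=
  (↑(RuleSet.predsF 𝓡) : Set ℕ) ⊆ ↑(RuleSet.predsF 𝓡') ∧
  ∀ F : FactBase, (∀ a ∈ F, a.pred ∈ RuleSet.predsF 𝓡) →
    (∀ M : Set Atom, IsUniversalModel 𝓡' F M →
      IsUniversalModel 𝓡 F (restrictTo M ↑(RuleSet.predsF 𝓡))) ∧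
    (∀ M : Set Atom, IsUniversalModel 𝓡 F M →
      ∃ M' : Set Atom, M ⊆ M' ∧ IsUniversalModel 𝓡' F M' ∧ termsOf M' = termsOf M ∧
        restrictTo M' ↑(RuleSet.predsF 𝓡) = restrictTo M ↑(RuleSet.predsF 𝓡))

theorem exists_list_of_encode_sort {α : Type*} [Encodable α] (s : Multiset α) {r : α → α → Prop}
    (h₁ : DecidableRel r) (h₂ : IsTrans α r) (h₃ : Std.Antisymm r) (h₄ : Std.Total r) {n : ℕ}
    (hn : n = Encodable.encode (s.sort r)) :
    ∃ l : List α, Encodable.encode l = n ∧ (l : Multiset α) = s :=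
  ⟨s.sort r, hn.symm, Multiset.sort_eq _ _⟩

theorem exists_list_encode_finset {α : Type*} [Encodable α] (s : Finset α) :
    ∃ l : List α, Encodable.encode l = Encodable.encode s ∧ (l : Multiset α) = s.val :=
  exists_list_of_encode_sort s.val _ _ _ _ rfl

def termEquiv : Term ≃ ℕ ⊕ ℕ where
  toFun := fun t => match t with | .const c => .inl c | .var v => .inr v
  invFun := fun s => match s with | .inl c => .const c | .inr v => .var v
  left_inv := by intro t; cases t <;> rfl
  right_inv := by intro s; cases s <;> rfl

instance : Primcodable Term where
  toEncodable := inferInstance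
  prim := (Primcodable.ofEquiv (ℕ ⊕ ℕ) termEquiv).prim

def atomEquiv : Atom ≃ ℕ × List Term where
  toFun := fun a => (a.pred, a.args)
  invFun := fun p => ⟨p.1, p.2⟩
  left_inv := fun _ => rfl
  right_inv := fun _ => rfl

instance : Primcodable Atom where
  toEncodable := inferInstance
  prim := (Primcodable.ofEquiv (ℕ × List Term) atomEquiv).prim

theorem exists_code_rule (R : Rule) : ∃ r : List Atom × List Atom,
    Encodable.encode r = Encodable.encode R ∧ (r.1 : Multiset Atom) = R.body.val ∧
      (r.2 : Multiset Atom) = R.head.val := by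
  obtain ⟨b, hb, hb'⟩ := exists_list_encode_finset R.body
  obtain ⟨h, hh, hh'⟩ := exists_list_encode_finset R.head
  refine ⟨(b, h), ?_, hb', hh'⟩
  exact congrArg₂ Nat.pair hb hh


theorem encode_map_of_encode_eq {α β : Type*} [Encodable α] [Encodable β] {f : α → β}
    (hf : ∀ a, Encodable.encode (f a) = Encodable.encode a) (l : List α) :
    Encodable.encode (l.map f) = Encodable.encode l := by
  induction l with
  | nil => rfl
  | cons a l ih => rw [List.map_cons, Encodable.encode_list_cons, Encodable.encode_list_cons, hf, ih]

/-- The lists of body and head atoms of a rule, with the same code as the rule. -/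
def Rule.code (R : Rule) : List Atom × List Atom := (exists_code_rule R).choose

theorem Rule.encode_code (R : Rule) : Encodable.encode R.code = Encodable.encode R :=
  (exists_code_rule R).choose_spec.1

theorem Rule.mem_code_fst {R : Rule} {a : Atom} : a ∈ R.code.1 ↔ a ∈ R.body := by
  rw [← Finset.mem_val, ← (exists_code_rule R).choose_spec.2.1]; rfl

theorem Rule.mem_code_snd {R : Rule} {a : Atom} : a ∈ R.code.2 ↔ a ∈ R.head := by
  rw [← Finset.mem_val, ← (exists_code_rule R).choose_spec.2.2]; rfl

theorem Rule.length_code_snd (R : Rule) : R.code.2.length = R.head.card := by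
  rw [Finset.card_def, ← (exists_code_rule R).choose_spec.2.2]; rfl

theorem exists_code_ruleSet (𝓡 : RuleSet) : ∃ l : List Rule,
    Encodable.encode (l.map Rule.code) = Encodable.encode 𝓡 ∧ ∀ R, R ∈ l ↔ R ∈ 𝓡 := by
  obtain ⟨l, hl, hl'⟩ := exists_list_encode_finset 𝓡
  refine ⟨l, (encode_map_of_encode_eq Rule.encode_code l).trans hl, fun R => ?_⟩
  rw [← Finset.mem_val, ← hl']
  rfl

/-! ### Terms of atoms -/

theorem Atom.mem_vars {a : Atom} {v : ℕ} : v ∈ a.vars ↔ Term.var v ∈ a.args := by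
  obtain ⟨p, l⟩ := a
  simp only [Atom.vars]
  induction l with
  | nil => simp
  | cons t l ih =>
    rw [List.foldr_cons, Finset.mem_union, ih, List.mem_cons]
    cases t <;> simp [Term.vars]

theorem FactBase.mem_vars {F : FactBase} {v : ℕ} :
    v ∈ FactBase.vars F ↔ ∃ a ∈ F, Term.var v ∈ a.args := by
  simp [FactBase.vars, Finset.mem_sup, Atom.mem_vars]

theorem mem_setVars {S : Set Atom} {v : ℕ} :
    v ∈ setVars S ↔ ∃ a ∈ S, Term.var v ∈ a.args := by
  simp [setVars, Atom.mem_vars]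

theorem applyTerm_congr {σ τ : Subst} {u : Term} (h : ∀ v, u = Term.var v → σ v = τ v) :
    applyTerm σ u = applyTerm τ u := by
  cases u with
  | const c => rfl
  | var v => exact h v rfl

theorem Atom.subst_congr {σ τ : Subst} {a : Atom}
    (h : ∀ v, Term.var v ∈ a.args → σ v = τ v) : a.subst σ = a.subst τ := by
  simp only [Atom.subst, Atom.mk.injEq, true_and]
  refine List.map_congr_left fun u hu => applyTerm_congr ?_
  rintro v rfl
  exact h v hu

theorem Atom.subst_var (a : Atom) : a.subst Term.var = a := by
  obtain ⟨p, l⟩ := a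
  simp only [Atom.subst, Atom.mk.injEq, true_and]
  refine (List.map_congr_left (g := id) fun u _ => ?_).trans (List.map_id l)
  cases u <;> rfl

/-! ### Syntactic characterization of applicability -/

/-- A term that a retraction onto a superset of `S` has to fix. -/
def IsOld (S : Set Atom) (u : Term) : Prop :=
  (∃ c, u = Term.const c) ∨ ∃ a ∈ S, u ∈ a.args

/-- `b` is the image of `a` under a substitution fixing the variables of `S`. -/
def Matches (S : Set Atom) (a b : Atom) : Prop :=
  a.pred = b.pred ∧ a.args.length = b.args.length ∧
    (∀ i < a.args.length, ∀ u ∈ a.args[i]?, IsOld S u → a.args[i]? = b.args[i]?) ∧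
    ∀ i < a.args.length, ∀ j < a.args.length,
      a.args[i]? = a.args[j]? → b.args[i]? = b.args[j]?

theorem IsOld.mono {S T : Set Atom} (h : S ⊆ T) {u : Term} (hu : IsOld S u) : IsOld T u :=
  hu.imp id fun ⟨a, ha, hu⟩ => ⟨a, h ha, hu⟩

theorem Matches.anti {S T : Set Atom} (h : S ⊆ T) {a b : Atom} (hm : Matches T a b) :
    Matches S a b :=
  ⟨hm.1, hm.2.1, fun i hi u hu ho => hm.2.2.1 i hi u hu (ho.mono h), hm.2.2.2⟩

theorem matches_subst {S : Set Atom} {σ : Subst} (hσ : ∀ v ∈ setVars S, σ v = Term.var v)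
    (a : Atom) : Matches S a (a.subst σ) := by
  refine ⟨rfl, by simp [Atom.subst], fun i _ u hu ho => ?_, fun i _ j _ h => ?_⟩
  · rw [Option.mem_def] at hu
    simp only [Atom.subst, List.getElem?_map, hu, Option.map_some, Option.some.injEq]
    rcases ho with ⟨c, rfl⟩ | ⟨b, hb, hub⟩
    · rfl
    · cases u with
      | const c => rfl
      | var v => exact (hσ v (mem_setVars.2 ⟨b, hb, hub⟩)).symm
  · simp only [Atom.subst, List.getElem?_map, h]

theorem exists_subst_of_matches {S : Set Atom} {a b : Atom} (h : Matches S a b) :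
    ∃ σ : Subst, (∀ v ∈ setVars S, σ v = Term.var v) ∧ a.subst σ = b := by
  obtain ⟨hp, hl, ho, he⟩ := h
  refine ⟨fun v => if v ∈ setVars S then Term.var v else
    b.args.getD (a.args.idxOf (Term.var v)) (Term.var v), fun v hv => if_pos hv, ?_⟩
  obtain ⟨p, l⟩ := a
  obtain ⟨q, m⟩ := b
  simp only at hp hl ho he
  subst hp
  simp only [Atom.subst, Atom.mk.injEq, true_and]
  refine List.ext_getElem (by simpa using hl) fun i hi hi' => ?_
  rw [List.length_map] at hi
  rw [List.getElem_map]
  have hli := List.getElem?_eq_getElem hi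
  have hmi := List.getElem?_eq_getElem hi'
  have hoi := ho i hi _ hli
  rw [hli, hmi, Option.some_inj] at hoi
  generalize hu : l[i] = u at *
  cases u with
  | const c => exact hoi (Or.inl ⟨c, rfl⟩)
  | var v =>
    simp only [applyTerm]
    split_ifs with hv
    · exact hoi (Or.inr (mem_setVars.1 hv))
    · have hmem : Term.var v ∈ l := hu ▸ List.getElem_mem hi
      have hlt := List.idxOf_lt_length_of_mem hmem
      have := he _ hlt i hi (by rw [hli, List.getElem?_eq_getElem hlt, List.getElem_idxOf])
      rw [List.getD_eq_getElem?_getD, this, hmi, Option.getD_some]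

theorem applicable_R_iff {t : Trigger} {F : FactBase} {a : Atom} (ha : t.out = {a}) :
    Applicable .R t F ↔ ∀ b ∈ F, ¬ Matches ↑F a b := by
  have hF : (F : Set Atom) ⊆ ↑(F ∪ t.out) := by simp
  rw [Applicable, ← not_iff_not, not_not]
  push Not
  constructor
  · rintro ⟨σ, hσ, hid⟩
    refine ⟨a.subst σ, hσ a (by simp [ha]), matches_subst (fun v hv => hid v ?_ hv) a⟩
    obtain ⟨b, hb, hv⟩ := hv
    exact ⟨b, hF hb, hv⟩
  · rintro ⟨b, hb, hm⟩
    obtain ⟨σ, hσ, rfl⟩ := exists_subst_of_matches hm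
    refine ⟨σ, fun c hc => ?_, fun v _ hv => hσ v hv⟩
    rw [ha, Finset.coe_union, Finset.coe_singleton, Set.union_singleton] at hc
    rcases hc with rfl | hc
    · exact hb
    · have : c.subst σ = c.subst Term.var :=
        Atom.subst_congr fun v hv => hσ v (mem_setVars.2 ⟨c, hc, hv⟩)
      rwa [this, Atom.subst_var]

theorem exists_out_eq_singleton {t : Trigger} (h : t.rule.IsAtomicHead) :
    ∃ a, t.out = {a} := by
  obtain ⟨b, hb⟩ := Finset.card_eq_one.1 h
  exact ⟨b.subst t.ext, by rw [Trigger.out, hb, Finset.image_singleton]⟩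

theorem not_applicable_of_out_subset {t : Trigger} {F : FactBase} (h : t.out ⊆ F) :
    ¬ Applicable .R t F := by
  rw [Applicable, not_not, Finset.union_eq_left.2 h]
  exact ⟨Term.var, fun a ha => by rwa [Atom.subst_var], fun v _ _ => rfl⟩

/-! ### Triggers -/

theorem Trigger.out_congr {t t' : Trigger} (hr : t.rule = t'.rule)
    (hm : ∀ v ∈ FactBase.vars t.rule.body, t.map v = t'.map v) : t.out = t'.out := by
  obtain ⟨R, σ⟩ := t
  obtain ⟨R', τ⟩ := t'
  obtain rfl : R = R' := hr
  refine Finset.image_congr fun a ha => Atom.subst_congr fun v hv => ?_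
  simp only [Trigger.ext]
  split_ifs with h
  · have : (FactBase.vars R.body).sort.map σ = (FactBase.vars R.body).sort.map τ :=
      List.map_congr_left fun v hv => hm v (by simpa using hv)
    simp only [Trigger.freshVar, this]
  · refine hm v ?_
    by_contra hb
    exact h (Finset.mem_sdiff.2 ⟨FactBase.mem_vars.2 ⟨a, ha, hv⟩, hb⟩)

theorem Trigger.IsOn.congr {t t' : Trigger} {F : FactBase} (ht : t.IsOn F) (hr : t.rule = t'.rule)
    (hm : ∀ v ∈ FactBase.vars t.rule.body, t.map v = t'.map v) : t'.IsOn F := by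
  intro a ha
  rw [← hr] at ha
  rw [← Atom.subst_congr fun v hv => hm v (FactBase.mem_vars.2 ⟨a, ha, hv⟩)]
  exact ht a ha

theorem applicable_R_congr {t t' : Trigger} {F : FactBase} (h : t.out = t'.out) :
    Applicable .R t F ↔ Applicable .R t' F := by
  rw [Applicable, Applicable, h]

theorem Trigger.IsOn.mono {t : Trigger} {F G : FactBase} (h : F ⊆ G) (ht : t.IsOn F) : t.IsOn G :=
  fun a ha => h (ht a ha)

/-! ### Infinite restricted derivations as sequences of triggers -/

/-- The `i`-th factbase obtained from `F` by applying a sequence of triggers. -/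
def fbSeq (F : FactBase) (s : ℕ → Trigger) : ℕ → FactBase
  | 0 => F
  | i + 1 => fbSeq F s i ∪ (s i).out

/-- The trigger `t` of `𝓡` is R-applicable on `F`. -/
def Fires (𝓡 : RuleSet) (F : FactBase) (t : Trigger) : Prop :=
  t.rule ∈ 𝓡 ∧ t.IsOn F ∧ Applicable .R t F

/-- The sequence `s` of triggers is an infinite R-derivation from `⟨𝓡, F⟩`. -/
def IsInfDer (𝓡 : RuleSet) (F : FactBase) (s : ℕ → Trigger) : Prop :=
  ∀ i, Fires 𝓡 (fbSeq F s i) (s i)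

theorem fbSeq_mono (F : FactBase) (s : ℕ → Trigger) : Monotone (fbSeq F s) :=
  monotone_nat_of_le_succ fun _ => Finset.subset_union_left

theorem fbSeq_congr {F : FactBase} {s s' : ℕ → Trigger} {n : ℕ} (h : ∀ i < n, s i = s' i) :
    fbSeq F s n = fbSeq F s' n := by
  induction n with
  | zero => rfl
  | succ n ih => rw [fbSeq, fbSeq, ih fun i hi => h i (by omega), h n (by omega)]

/-- Insert the trigger `t` at position `n` into a sequence of triggers. -/
def insertTrigger (s : ℕ → Trigger) (n : ℕ) (t : Trigger) (i : ℕ) : Trigger :=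
  if i < n then s i else if i = n then t else s (i - 1)

theorem insertTrigger_of_lt {s : ℕ → Trigger} {n : ℕ} {t : Trigger} {i : ℕ} (h : i < n) :
    insertTrigger s n t i = s i := if_pos h

theorem insertTrigger_self (s : ℕ → Trigger) (n : ℕ) (t : Trigger) :
    insertTrigger s n t n = t := by simp [insertTrigger]

theorem insertTrigger_succ {s : ℕ → Trigger} {n : ℕ} {t : Trigger} {i : ℕ} (h : n ≤ i) :
    insertTrigger s n t (i + 1) = s i := by
  rw [insertTrigger, if_neg (by omega), if_neg (by omega), Nat.add_sub_cancel]

theorem fbSeq_insertTrigger_of_le {F : FactBase} {s : ℕ → Trigger} {n : ℕ} {t : Trigger} {i : ℕ}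
    (h : i ≤ n) : fbSeq F (insertTrigger s n t) i = fbSeq F s i :=
  fbSeq_congr fun _ hj => insertTrigger_of_lt (by omega)

theorem fbSeq_insertTrigger_succ {F : FactBase} {s : ℕ → Trigger} {n : ℕ} {t : Trigger} {i : ℕ}
    (h : n ≤ i) : fbSeq F (insertTrigger s n t) (i + 1) = fbSeq F s i ∪ t.out := by
  induction i, h using Nat.le_induction with
  | base => rw [fbSeq, fbSeq_insertTrigger_of_le le_rfl, insertTrigger_self]
  | succ i hi ih =>
    rw [fbSeq, ih, insertTrigger_succ hi, fbSeq, Finset.union_right_comm]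

/-- If a match of `b` (over `S`) and a match of `c` (over `T`) onto the same atom have the same
old positions and the same equalities between positions, then `c` matches `b`. -/
theorem Matches.trans_of_pattern {S T : Set Atom} {a b c : Atom} (hb : Matches S b a)
    (hc : Matches T c a)
    (hold : ∀ i < a.args.length, (∃ u ∈ c.args[i]?, IsOld T u) → ∃ u ∈ b.args[i]?, IsOld S u)
    (heq : ∀ i < a.args.length, ∀ j < a.args.length,
      c.args[i]? = c.args[j]? → b.args[i]? = b.args[j]?) :
    Matches T c b := by
  refine ⟨hc.1.trans hb.1.symm, hc.2.1.trans hb.2.1.symm, fun i hi u hu ho => ?_,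
    fun i hi j hj h => ?_⟩
  · rw [hc.2.1] at hi
    obtain ⟨w, hw, hwo⟩ := hold i hi ⟨u, hu, ho⟩
    rw [hc.2.2.1 i (hc.2.1 ▸ hi) u hu ho, hb.2.2.1 i (hb.2.1 ▸ hi) w hw hwo]
  · rw [hc.2.1] at hi hj
    exact heq i hi j hj h

/-- A single atom deactivates only finitely many triggers of an R-derivation. -/
theorem finite_setOf_matches {𝓡 : RuleSet} {F : FactBase} {s : ℕ → Trigger} {o : ℕ → Atom}
    (hs : IsInfDer 𝓡 F s) (ho : ∀ i, (s i).out = {o i}) (a : Atom) :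
    {i | Matches ↑(fbSeq F s i) (o i) a}.Finite := by
  by_contra hinf
  let n := a.args.length
  let pat : ℕ → Finset ℕ × Finset (ℕ × ℕ) := fun i =>
    ((Finset.range n).filter fun p => ∃ u ∈ (o i).args[p]?, IsOld ↑(fbSeq F s i) u,
      (Finset.range n ×ˢ Finset.range n).filter fun p => (o i).args[p.1]? = (o i).args[p.2]?)
  have hmaps : Set.MapsTo pat {i | Matches ↑(fbSeq F s i) (o i) a}
      ↑((Finset.range n).powerset ×ˢ (Finset.range n ×ˢ Finset.range n).powerset) := by
    intro i _
    simp only [Finset.coe_product, Set.mem_prod, Finset.mem_coe, Finset.mem_powerset]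
    exact ⟨Finset.filter_subset _ _, Finset.filter_subset _ _⟩
  obtain ⟨j, hj, k, hk, hjk, hpat⟩ :=
    Set.Infinite.exists_lt_map_eq_of_mapsTo hinf hmaps (Finset.finite_toSet _)
  obtain ⟨h₁, h₂⟩ := Prod.ext_iff.1 hpat
  refine (applicable_R_iff (ho k)).1 (hs k).2.2 (o j)
    (fbSeq_mono F s (Nat.succ_le_of_lt hjk) ?_) (Matches.trans_of_pattern hj hk ?_ ?_)
  · exact Finset.mem_union_right _ (by simp [ho])
  · intro i hi hu
    have : i ∈ (pat k).1 := Finset.mem_filter.2 ⟨Finset.mem_range.2 hi, hu⟩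
    rw [← h₁] at this
    exact (Finset.mem_filter.1 this).2
  · intro i hi i' hi' hu
    have : (i, i') ∈ (pat k).2 := Finset.mem_filter.2
      ⟨Finset.mem_product.2 ⟨Finset.mem_range.2 hi, Finset.mem_range.2 hi'⟩, hu⟩
    rw [← h₂] at this
    exact (Finset.mem_filter.1 this).2

/-- A persistently applicable trigger can be inserted late into an infinite R-derivation. -/
theorem IsInfDer.exists_insert {𝓡 : RuleSet} {F : FactBase} {s : ℕ → Trigger}
    (hat : ∀ R ∈ 𝓡, R.IsAtomicHead) (hs : IsInfDer 𝓡 F s) {t : Trigger} {i : ℕ}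
    (ht : ∀ j, i < j → Fires 𝓡 (fbSeq F s j) t) (e : ℕ) :
    ∃ n, e ≤ n ∧ i < n ∧ IsInfDer 𝓡 F (insertTrigger s n t) := by
  choose o ho using fun j => exists_out_eq_singleton (hat _ (hs j).1)
  obtain ⟨a, ha⟩ := exists_out_eq_singleton (hat _ (ht _ i.lt_succ_self).1)
  obtain ⟨m, hm⟩ := (finite_setOf_matches hs ho a).bddAbove
  refine ⟨max (max e (i + 1)) (m + 1), by omega, by omega, fun j => ?_⟩
  set n := max (max e (i + 1)) (m + 1)
  rcases lt_trichotomy j n with hj | rfl | hj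
  · rw [fbSeq_insertTrigger_of_le hj.le, insertTrigger_of_lt hj]
    exact hs j
  · rw [fbSeq_insertTrigger_of_le le_rfl, insertTrigger_self]
    exact ht _ (by omega)
  · obtain ⟨j, rfl⟩ : ∃ k, j = k + 1 := ⟨j - 1, by omega⟩
    have hnj : n ≤ j := by omega
    rw [fbSeq_insertTrigger_succ hnj, insertTrigger_succ hnj]
    refine ⟨(hs j).1, (hs j).2.1.mono Finset.subset_union_left,
      (applicable_R_iff (ho j)).2 fun b hb hmatch => ?_⟩
    replace hmatch := hmatch.anti (Finset.coe_subset.2 Finset.subset_union_left)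
    rcases Finset.mem_union.1 hb with hb | hb
    · exact (applicable_R_iff (ho j)).1 (hs j).2.2 b hb hmatch
    · rw [ha, Finset.mem_singleton] at hb
      subst hb
      have := hm hmatch
      omega

/-- One step of the fairness construction: change an infinite R-derivation beyond position `e`
so that a given trigger is not applicable at some position between `i` and `e'`. -/
theorem IsInfDer.exists_deactivate {𝓡 : RuleSet} {F : FactBase} {s : ℕ → Trigger}
    (hat : ∀ R ∈ 𝓡, R.IsAtomicHead) (hs : IsInfDer 𝓡 F s) (t : Trigger) (i e : ℕ) :
    ∃ s' e', IsInfDer 𝓡 F s' ∧ e < e' ∧ (∀ j < e, s' j = s j) ∧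
      (t.rule ∈ 𝓡 → t.IsOn (fbSeq F s i) →
        ∃ j, i < j ∧ j ≤ e' ∧ ¬ Applicable .R t (fbSeq F s' j)) := by
  by_cases hR : t.rule ∈ 𝓡 ∧ t.IsOn (fbSeq F s i)
  swap
  · exact ⟨s, e + 1, hs, e.lt_succ_self, fun _ _ => rfl, fun h₁ h₂ => (hR ⟨h₁, h₂⟩).elim⟩
  by_cases hA : ∃ j, i < j ∧ ¬ Applicable .R t (fbSeq F s j)
  · obtain ⟨j, hij, hj⟩ := hA
    exact ⟨s, max (e + 1) j, hs, by omega, fun _ _ => rfl, fun _ _ => ⟨j, hij, by omega, hj⟩⟩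
  · push Not at hA
    obtain ⟨n, hen, hin, hn⟩ := hs.exists_insert hat (t := t) (i := i)
      (fun j hj => ⟨hR.1, hR.2.mono (fbSeq_mono F s hj.le), hA j hj⟩) e
    refine ⟨_, n + 1, hn, by omega, fun j hj => insertTrigger_of_lt (by omega),
      fun _ _ => ⟨n + 1, by omega, le_rfl, not_applicable_of_out_subset ?_⟩⟩
    rw [fbSeq_insertTrigger_succ le_rfl]
    exact Finset.subset_union_right

/-- The substitution given by a list of terms. -/
def listSubst (l : List Term) : Subst := fun v => l.getD v (Term.const 0)

theorem exists_listSubst (s : Finset ℕ) (σ : Subst) :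
    ∃ l, ∀ v ∈ s, listSubst l v = σ v := by
  refine ⟨(List.range (s.sup id + 1)).map σ, fun v hv => ?_⟩
  have : v < s.sup id + 1 := Nat.lt_succ_of_le (Finset.le_sup (f := id) hv)
  simp [listSubst, List.getD_eq_getElem?_getD, List.getElem?_range this]

/-- The fairness theorem for atomic-head rules: an infinite R-derivation can be turned into an
infinite fair one. -/
theorem IsInfDer.exists_fair {𝓡 : RuleSet} {F : FactBase} {s : ℕ → Trigger}
    (hat : ∀ R ∈ 𝓡, R.IsAtomicHead) (hs : IsInfDer 𝓡 F s) :
    ∃ s', IsInfDer 𝓡 F s' ∧ ∀ i (t : Trigger), t.rule ∈ 𝓡 → t.IsOn (fbSeq F s' i) →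
      ∃ j, i < j ∧ ¬ Applicable .R t (fbSeq F s' j) := by
  let req : ℕ → Option (Rule × List Term) := fun n => Encodable.decode n.unpair.2
  have step : ∀ (p : {p : (ℕ → Trigger) × ℕ // IsInfDer 𝓡 F p.1}) (n : ℕ),
      ∃ q : {p : (ℕ → Trigger) × ℕ // IsInfDer 𝓡 F p.1}, p.1.2 < q.1.2 ∧
        (∀ j < p.1.2, q.1.1 j = p.1.1 j) ∧
        ∀ R l, req n = some (R, l) → R ∈ 𝓡 →
          (Trigger.mk R (listSubst l)).IsOn (fbSeq F p.1.1 n.unpair.1) →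
          ∃ j, n.unpair.1 < j ∧ j ≤ q.1.2 ∧
            ¬ Applicable .R ⟨R, listSubst l⟩ (fbSeq F q.1.1 j) := by
    rintro ⟨⟨s, e⟩, hs⟩ n
    rcases hreq : req n with _ | ⟨R, l⟩
    · exact ⟨⟨(s, e + 1), hs⟩, e.lt_succ_self, fun _ _ => rfl, fun _ _ h => nomatch h⟩
    · obtain ⟨s', e', hs', he, hagree, hd⟩ :=
        hs.exists_deactivate hat ⟨R, listSubst l⟩ n.unpair.1 e
      refine ⟨⟨(s', e'), hs'⟩, he, hagree, fun R' l' h => ?_⟩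
      obtain ⟨rfl, rfl⟩ := Prod.mk.inj (Option.some.inj h)
      exact hd
  choose next hlt hagree hdeact using step
  let st : ℕ → {p : (ℕ → Trigger) × ℕ // IsInfDer 𝓡 F p.1} :=
    fun n => Nat.rec ⟨(s, 0), hs⟩ (fun n p => next p n) n
  have hmono : StrictMono fun n => (st n).1.2 := strictMono_nat_of_lt_succ fun n => hlt (st n) n
  have hst : ∀ n m, n ≤ m → ∀ j < (st n).1.2, (st m).1.1 j = (st n).1.1 j := by
    intro n m hnm
    induction m, hnm using Nat.le_induction with
    | base => exact fun _ _ => rfl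
    | succ m hm ih =>
      intro j hj
      exact (hagree (st m) m j (hj.trans_le (hmono.monotone hm))).trans (ih j hj)
  let w : ℕ → Trigger := fun i => (st (i + 1)).1.1 i
  have hw : ∀ n, ∀ j < (st n).1.2, w j = (st n).1.1 j := by
    intro n j hj
    rcases le_total n (j + 1) with h | h
    · exact hst n (j + 1) h j hj
    · exact (hst (j + 1) n h j (hmono.le_apply (x := j + 1))).symm
  have hfb : ∀ n i, i ≤ (st n).1.2 → fbSeq F w i = fbSeq F (st n).1.1 i := fun n i hi =>
    fbSeq_congr fun j hj => hw n j (hj.trans_le hi)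
  refine ⟨w, fun i => ?_, fun i t htR hton => ?_⟩
  · rw [hfb (i + 1) i ((Nat.le_succ i).trans hmono.le_apply)]
    exact (st (i + 1)).2 i
  · obtain ⟨l, hl⟩ := exists_listSubst (FactBase.vars t.rule.body) t.map
    let n := Nat.pair i (Encodable.encode (t.rule, l))
    have hn : n.unpair.1 = i := by simp [n]
    have hreq : req n = some (t.rule, l) := by simp [req, n]
    have hin : i ≤ (st n).1.2 := (Nat.left_le_pair _ _).trans hmono.le_apply
    have hon : (Trigger.mk t.rule (listSubst l)).IsOn (fbSeq F w i) :=
      hton.congr rfl fun v hv => (hl v hv).symm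
    rw [hfb n i hin] at hon
    obtain ⟨j, hij, hje, hj⟩ := hdeact (st n) n _ _ hreq htR (by rwa [hn])
    rw [hn] at hij
    refine ⟨j, hij, ?_⟩
    rw [applicable_R_congr (Trigger.out_congr (t := t) (t' := ⟨t.rule, listSubst l⟩) rfl
      fun v hv => (hl v hv).symm), hfb (n + 1) j hje]
    exact hj

/-- The derivation given by an infinite sequence of triggers. -/
def IsInfDer.toDerivation {𝓡 : RuleSet} {F : FactBase} {s : ℕ → Trigger}
    (hs : IsInfDer 𝓡 F s) : Derivation 𝓡 F where
  len := ⊤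
  fb := fbSeq F s
  tr := s
  fb_zero := rfl
  rule_mem := fun i _ => (hs i).1
  trig_on := fun i _ => (hs i).2.1
  trig_new := fun i _ h => not_applicable_of_out_subset h (hs i).2.2
  fb_succ := fun _ _ => rfl
  fb_stall := fun i h => (h (ENat.natCast_lt_top i)).elim

theorem not_isInfDer_of_fair_finite {𝓡 : RuleSet} {F : FactBase}
    (hat : ∀ R ∈ 𝓡, R.IsAtomicHead)
    (hfin : ∀ D : Derivation 𝓡 F, D.IsX Variant.R → D.Fair Variant.R → D.Finite)
    (s : ℕ → Trigger) : ¬ IsInfDer 𝓡 F s := by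
  intro hs
  obtain ⟨w, hw, hfair⟩ := hs.exists_fair hat
  refine hfin hw.toDerivation (fun i _ => (hw i).2.2) (fun i _ t ht hon _ => ?_) rfl
  obtain ⟨j, hij, hj⟩ := hfair i t ht hon
  exact ⟨j, hij, le_top, hj⟩


/-! ### Runs of given length -/

/-- There is an R-derivation of length `n` from `⟨𝓡, F⟩`. -/
def HasRun (𝓡 : RuleSet) : ℕ → FactBase → Prop
  | 0, _ => True
  | n + 1, F => ∃ t, Fires 𝓡 F t ∧ HasRun 𝓡 n (F ∪ t.out)

theorem HasRun.of_succ {𝓡 : RuleSet} {n : ℕ} {F : FactBase} (h : HasRun 𝓡 (n + 1) F) :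
    HasRun 𝓡 n F := by
  induction n generalizing F with
  | zero => trivial
  | succ n ih =>
    obtain ⟨t, ht, hn⟩ := h
    exact ⟨t, ht, ih hn⟩

theorem HasRun.anti {𝓡 : RuleSet} {F : FactBase} {m n : ℕ} (hmn : m ≤ n) (h : HasRun 𝓡 n F) :
    HasRun 𝓡 m F := by
  induction n, hmn using Nat.le_induction with
  | base => exact h
  | succ n _ ih => exact ih h.of_succ

theorem Derivation.hasRun {𝓡 : RuleSet} {F : FactBase} (D : Derivation 𝓡 F)
    (hD : D.IsX Variant.R) {n i : ℕ} (h : ((i + n : ℕ) : ℕ∞) ≤ D.len) :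
    HasRun 𝓡 n (D.fb i) := by
  induction n generalizing i with
  | zero => trivial
  | succ n ih =>
    have hi : (i : ℕ∞) < D.len := lt_of_lt_of_le (by exact_mod_cast (by omega)) h
    refine ⟨D.tr i, ⟨D.rule_mem i hi, D.trig_on i hi, hD i hi⟩, ?_⟩
    rw [← D.fb_succ i hi]
    exact ih (by rwa [show i + 1 + n = i + (n + 1) by omega])

/-! ### The successors of a factbase, computed on lists -/

/-- A bound on the indices of the variables of a list of atoms. -/
def varBound (L : List Atom) : ℕ :=
  (L.flatMap Atom.args).foldr (fun u m => max (Encodable.encode u + 1) m) 0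

/-- The sorted list of variables of a list of atoms. -/
def sortedVars (L : List Atom) : List ℕ :=
  (List.range (varBound L)).filter fun v => ∃ a ∈ L, Term.var v ∈ a.args

/-- The fresh variables of the trigger given by a coded rule and a list of terms. -/
def codeFreshVar (r : List Atom × List Atom) (l : List Term) (v : ℕ) : ℕ :=
  Nat.pair (Encodable.encode (r, (sortedVars r.1).map (listSubst l))) v

/-- The extended substitution of the trigger given by a coded rule and a list of terms. -/
def codeExt (r : List Atom × List Atom) (l : List Term) (v : ℕ) : Term :=
  if ∃ a ∈ r.1, Term.var v ∈ a.args then listSubst l v else Term.var (codeFreshVar r l v)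

/-- The lists of length `n` with entries in `us`. -/
def tuples (us : List Term) (n : ℕ) : List (List Term) :=
  (fun ls => ls.flatMap fun l => us.map fun u => u :: l)^[n] [[]]

/-- The trigger given by `r` and `l` with output atom `a` is R-applicable on `L`. -/
def CodeFires (L : List Atom) (r : List Atom × List Atom) (l : List Term) (a : Atom) : Prop :=
  (∀ b ∈ r.1, b.subst (listSubst l) ∈ L) ∧ ∀ b ∈ L, ¬ Matches {c | c ∈ L} a b

/-- The successors of the factbase `L` by application of a rule in `rs`. -/
def succs (rs : List (List Atom × List Atom)) (L : List Atom) : List (List Atom) :=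
  rs.flatMap fun r =>
    (tuples (Term.const 0 :: L.flatMap Atom.args) (varBound r.1)).flatMap fun l =>
      r.2.flatMap fun h =>
        if CodeFires L r l (h.subst (codeExt r l)) then [h.subst (codeExt r l) :: L] else []

/-- The factbases reachable in `n` steps from those in `Ls`. -/
def level (rs : List (List Atom × List Atom)) (Ls : List (List Atom)) (n : ℕ) :
    List (List Atom) :=
  (fun Ls => Ls.flatMap (succs rs))^[n] Ls

theorem lt_varBound {L : List Atom} {a : Atom} {v : ℕ} (ha : a ∈ L) (hv : Term.var v ∈ a.args) :
    v < varBound L := by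
  have hmem : Term.var v ∈ L.flatMap Atom.args := List.mem_flatMap.2 ⟨a, ha, hv⟩
  rw [varBound]
  generalize L.flatMap Atom.args = us at hmem
  induction us with
  | nil => simp at hmem
  | cons u us ih =>
    rw [List.foldr_cons]
    rcases List.mem_cons.1 hmem with rfl | h
    · have : v ≤ Encodable.encode (Term.var v) := by
        change v ≤ 2 * v + 1
        omega
      omega
    · have := ih h
      omega

theorem mem_tuples {us l : List Term} (h : ∀ u ∈ l, u ∈ us) : l ∈ tuples us l.length := by
  induction l with
  | nil => simp [tuples]
  | cons u l ih =>
    rw [tuples, List.length_cons, Function.iterate_succ_apply']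
    simp only [List.mem_flatMap, List.mem_map]
    exact ⟨l, ih fun v hv => h v (List.mem_cons_of_mem _ hv), u, h u List.mem_cons_self, rfl⟩

theorem Rule.exists_mem_code_iff {R : Rule} {v : ℕ} :
    (∃ a ∈ R.code.1, Term.var v ∈ a.args) ↔ v ∈ FactBase.vars R.body := by
  simp only [Rule.mem_code_fst, FactBase.mem_vars]

theorem Rule.sortedVars_code (R : Rule) :
    sortedVars R.code.1 = (FactBase.vars R.body).sort (· ≤ ·) := by
  refine List.Perm.eq_of_pairwise' (r := (· ≤ ·)) ?_ (Finset.pairwise_sort _ _)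
    ((List.perm_ext_iff_of_nodup ?_ (Finset.sort_nodup _ _)).2 fun v => ?_)
  · exact (List.pairwise_lt_range.imp le_of_lt).filter _
  · exact List.nodup_range.filter _
  · rw [sortedVars, List.mem_filter, Finset.mem_sort, decide_eq_true_iff, List.mem_range,
      Rule.exists_mem_code_iff]
    refine ⟨fun h => h.2, fun h => ⟨?_, h⟩⟩
    obtain ⟨a, ha, hv⟩ := Rule.exists_mem_code_iff.2 h
    exact lt_varBound ha hv

theorem subst_ext_eq_codeExt {R : Rule} {l : List Term} {h : Atom} (hh : h ∈ R.head) :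
    h.subst (Trigger.mk R (listSubst l)).ext = h.subst (codeExt R.code l) := by
  refine Atom.subst_congr fun v hv => ?_
  have hfresh : (Trigger.mk R (listSubst l)).freshVar v = codeFreshVar R.code l v := by
    rw [Trigger.freshVar, codeFreshVar, Rule.sortedVars_code]
    exact congrArg (fun n => Nat.pair (Nat.pair n _) v) R.encode_code.symm
  have hhead : v ∈ FactBase.vars R.head := FactBase.mem_vars.2 ⟨h, hh, hv⟩
  simp only [Trigger.ext, codeExt, Rule.exVars, Finset.mem_sdiff, hhead, true_and, hfresh,
    Rule.exists_mem_code_iff]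
  split_ifs <;> simp_all

theorem codeFires_iff {R : Rule} {L : List Atom} {l : List Term} {a : Atom}
    (ha : (Trigger.mk R (listSubst l)).out = {a}) :
    CodeFires L R.code l a ↔ (Trigger.mk R (listSubst l)).IsOn L.toFinset ∧
      Applicable .R ⟨R, listSubst l⟩ L.toFinset := by
  rw [applicable_R_iff ha, CodeFires, Trigger.IsOn, IsHom]
  simp [Rule.mem_code_fst]

theorem exists_mem_tuples {t : Trigger} {L : List Atom} (ht : t.IsOn L.toFinset) :
    ∃ l ∈ tuples (Term.const 0 :: L.flatMap Atom.args) (varBound t.rule.code.1),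
      ∀ v ∈ FactBase.vars t.rule.body, t.map v = listSubst l v := by
  let l := (List.range (varBound t.rule.code.1)).map fun v =>
    if v ∈ FactBase.vars t.rule.body then t.map v else Term.const 0
  refine ⟨l, ?_, fun v hv => ?_⟩
  · have hl : l.length = varBound t.rule.code.1 := by simp [l]
    rw [← hl]
    refine mem_tuples fun u hu => ?_
    obtain ⟨v, -, rfl⟩ := List.mem_map.1 hu
    split_ifs with hv
    · obtain ⟨a, ha, hva⟩ := FactBase.mem_vars.1 hv
      refine List.mem_cons_of_mem _ (List.mem_flatMap.2 ⟨a.subst t.map, ?_, ?_⟩)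
      · simpa using ht a ha
      · exact List.mem_map.2 ⟨_, hva, rfl⟩
    · exact List.mem_cons_self
  · obtain ⟨a, ha, hva⟩ := Rule.exists_mem_code_iff.2 hv
    simp [listSubst, l, List.getD_eq_getElem?_getD, List.getElem?_range (lt_varBound ha hva), hv]

theorem mem_succs {𝓡 : RuleSet} {ls : List Rule} (hls : ∀ R, R ∈ ls ↔ R ∈ 𝓡)
    (hat : ∀ R ∈ 𝓡, R.IsAtomicHead) {L : List Atom} {G : FactBase} :
    (∃ L' ∈ succs (ls.map Rule.code) L, L'.toFinset = G) ↔
      ∃ t, Fires 𝓡 L.toFinset t ∧ L.toFinset ∪ t.out = G := by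
  have hout : ∀ {R : Rule} {l : List Term} {h : Atom}, R ∈ 𝓡 → h ∈ R.code.2 →
      (Trigger.mk R (listSubst l)).out = {h.subst (codeExt R.code l)} := by
    intro R l h hR hh
    rw [Rule.mem_code_snd] at hh
    obtain ⟨b, hb⟩ := Finset.card_eq_one.1 (hat R hR)
    obtain rfl : h = b := by simpa [hb] using hh
    rw [← subst_ext_eq_codeExt hh, Trigger.out, hb, Finset.image_singleton]
  simp only [succs, List.mem_flatMap, List.mem_map]
  constructor
  · rintro ⟨L', ⟨_, ⟨R, hR, rfl⟩, l, -, h, hh, hL'⟩, rfl⟩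
    rw [hls] at hR
    split_ifs at hL' with hf
    · rw [List.mem_singleton] at hL'
      subst hL'
      refine ⟨⟨R, listSubst l⟩, ⟨hR, (codeFires_iff (hout hR hh)).1 hf⟩, ?_⟩
      rw [hout hR hh, List.toFinset_cons, Finset.insert_eq, Finset.union_comm]
    · simp at hL'
  · rintro ⟨t, ⟨hR, hon, happ⟩, rfl⟩
    obtain ⟨l, hl, hmap⟩ := exists_mem_tuples hon
    obtain ⟨h, hh⟩ := t.rule.head_nonempty
    rw [← Rule.mem_code_snd] at hh
    have ho : t.out = (Trigger.mk t.rule (listSubst l)).out := Trigger.out_congr rfl hmap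
    refine ⟨h.subst (codeExt t.rule.code l) :: L,
      ⟨t.rule.code, ⟨t.rule, (hls _).2 hR, rfl⟩, l, hl, h, hh, ?_⟩, ?_⟩
    · rw [if_pos ((codeFires_iff (hout hR hh)).2 ⟨hon.congr rfl hmap,
        (applicable_R_congr ho).1 happ⟩)]
      exact List.mem_singleton_self _
    · rw [ho, hout hR hh, List.toFinset_cons, Finset.insert_eq, Finset.union_comm]

theorem level_ne_nil_iff {𝓡 : RuleSet} {ls : List Rule} (hls : ∀ R, R ∈ ls ↔ R ∈ 𝓡)
    (hat : ∀ R ∈ 𝓡, R.IsAtomicHead) {n : ℕ} {Ls : List (List Atom)} :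
    level (ls.map Rule.code) Ls n ≠ [] ↔ ∃ L ∈ Ls, HasRun 𝓡 n L.toFinset := by
  induction n generalizing Ls with
  | zero => cases Ls <;> simp [level, HasRun]
  | succ n ih =>
    rw [level, Function.iterate_succ_apply]
    refine ih.trans ?_
    simp only [List.mem_flatMap, HasRun]
    constructor
    · rintro ⟨M, ⟨L, hL, hM⟩, h⟩
      obtain ⟨t, ht, hG⟩ := (mem_succs hls hat).1 ⟨M, hM, rfl⟩
      exact ⟨L, hL, t, ht, hG ▸ h⟩
    · rintro ⟨L, hL, t, ht, h⟩
      obtain ⟨M, hM, hG⟩ := (mem_succs hls hat).2 ⟨t, ht, rfl⟩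
      exact ⟨M, ⟨L, hL, hM⟩, hG ▸ h⟩

/-- The König lemma for R-derivations: arbitrarily long ones yield an infinite one. -/
theorem exists_isInfDer {𝓡 : RuleSet} (hat : ∀ R ∈ 𝓡, R.IsAtomicHead) {F : FactBase}
    (hF : ∀ n, HasRun 𝓡 n F) : ∃ s, IsInfDer 𝓡 F s := by
  obtain ⟨ls, -, hls⟩ := exists_code_ruleSet 𝓡
  have step : ∀ G : {G : FactBase // ∀ n, HasRun 𝓡 n G},
      ∃ t, Fires 𝓡 G.1 t ∧ ∀ n, HasRun 𝓡 n (G.1 ∪ t.out) := by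
    rintro ⟨G, hG⟩
    by_contra! hcon
    have hb : ∀ L' ∈ succs (ls.map Rule.code) G.toList, ∃ n, ¬ HasRun 𝓡 n L'.toFinset := by
      intro L' hL'
      obtain ⟨t, ht, hGt⟩ := (mem_succs hls hat).1 ⟨L', hL', rfl⟩
      rw [Finset.toList_toFinset] at ht hGt
      rw [← hGt]
      exact hcon t ht
    choose! b hb using hb
    let B := ((succs (ls.map Rule.code) G.toList).map b).sum
    obtain ⟨t, ht, hrun⟩ := hG (B + 1)
    obtain ⟨L', hL', hGt⟩ := (mem_succs hls hat (L := G.toList) (G := G ∪ t.out)).2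
      ⟨t, by rwa [Finset.toList_toFinset], by rw [Finset.toList_toFinset]⟩
    rw [← hGt] at hrun
    exact hb L' hL' (hrun.anti (List.single_le_sum (by simp) _ (List.mem_map_of_mem hL')))
  choose t ht hrun using step
  let st : ℕ → {G : FactBase // ∀ n, HasRun 𝓡 n G} :=
    fun n => Nat.rec ⟨F, hF⟩ (fun _ G => ⟨_, hrun G⟩) n
  have hfb : ∀ n, fbSeq F (fun n => t (st n)) n = (st n).1 := by
    intro n
    induction n with
    | zero => rfl
    | succ n ih => rw [fbSeq, ih]
  exact ⟨fun n => t (st n), fun n => by rw [hfb]; exact ht (st n)⟩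

theorem fair_finite_iff {𝓡 : RuleSet} {F : FactBase} (hat : ∀ R ∈ 𝓡, R.IsAtomicHead) :
    (∀ D : Derivation 𝓡 F, D.IsX Variant.R → D.Fair Variant.R → D.Finite) ↔
      ∃ n, ¬ HasRun 𝓡 n F := by
  constructor
  · intro h
    by_contra! hrun
    obtain ⟨s, hs⟩ := exists_isInfDer hat hrun
    exact not_isInfDer_of_fair_finite hat h s hs
  · rintro ⟨n, hn⟩ D hD - hlen
    exact hn (D.fb_zero ▸ D.hasRun hD (i := 0) (by simp [hlen]))


/-! ### Computability -/

section Primrec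

variable {α β : Type*} [Primcodable α] [Primcodable β]

theorem PrimrecRel.forall_mem_comp {f : α → List β} {p : α → β → Prop} (hf : Primrec f)
    (hp : PrimrecRel p) : PrimrecPred fun a => ∀ b ∈ f a, p a b :=
  PrimrecRel.comp hp.swap.forall_mem_list hf Primrec.id

theorem PrimrecRel.exists_mem_comp {f : α → List β} {p : α → β → Prop} (hf : Primrec f)
    (hp : PrimrecRel p) : PrimrecPred fun a => ∃ b ∈ f a, p a b :=
  PrimrecRel.comp hp.swap.exists_mem_list hf Primrec.id

theorem PrimrecRel.forall_lt_comp {f : α → ℕ} {p : α → ℕ → Prop} (hf : Primrec f)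
    (hp : PrimrecRel p) : PrimrecPred fun a => ∀ n < f a, p a n :=
  (PrimrecRel.forall_mem_comp (Primrec.list_range.comp hf) hp).of_eq fun a => by simp

theorem PrimrecPred.imp {p q : α → Prop} (hp : PrimrecPred p) (hq : PrimrecPred q) :
    PrimrecPred fun a => p a → q a :=
  (hp.not.or hq).of_eq fun a => by tauto

theorem PrimrecPred.mem_list {f : α → β} {g : α → List β} (hf : Primrec f) (hg : Primrec g) :
    PrimrecPred fun a => f a ∈ g a :=
  (PrimrecRel.exists_mem_comp (p := fun a b => f a = b) hg
    (Primrec.eq.comp (hf.comp Primrec.fst) Primrec.snd)).of_eq fun a => by simp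

theorem PrimrecPred.ite {p : α → Prop} {f g : α → β} {_ : DecidablePred p} (hp : PrimrecPred p)
    (hf : Primrec f) (hg : Primrec g) : Primrec fun a => if p a then f a else g a :=
  Primrec.ite hp hf hg

theorem primrec_const : Primrec Term.const :=
  (Primrec.of_equiv_symm (e := termEquiv)).comp Primrec.sumInl

theorem primrec_var : Primrec Term.var :=
  (Primrec.of_equiv_symm (e := termEquiv)).comp Primrec.sumInr

theorem primrec_pred : Primrec Atom.pred :=
  Primrec.fst.comp (Primrec.of_equiv (e := atomEquiv))

theorem primrec_args : Primrec Atom.args :=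
  Primrec.snd.comp (Primrec.of_equiv (e := atomEquiv))

theorem primrec_atom_mk : Primrec₂ Atom.mk :=
  ((Primrec.of_equiv_symm (e := atomEquiv)).comp Primrec.id).to₂

theorem primrec_applyTerm {g : α → Subst} {f : α → Term} (hg : Primrec₂ g) (hf : Primrec f) :
    Primrec fun a => applyTerm (g a) (f a) := by
  refine (Primrec.sumCasesOn ((Primrec.of_equiv (e := termEquiv)).comp hf)
    (primrec_const.comp Primrec.snd).to₂ hg).of_eq fun a => ?_
  cases f a <;> rfl

theorem primrec_subst {g : α → Subst} {f : α → Atom} (hg : Primrec₂ g) (hf : Primrec f) :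
    Primrec fun a => (f a).subst (g a) :=
  primrec_atom_mk.comp (primrec_pred.comp hf) <|
    Primrec.list_map (g := fun a => applyTerm (g a)) (primrec_args.comp hf) <|
      primrec_applyTerm (g := fun p : α × Term => g p.1)
        (hg.comp (Primrec.fst.comp Primrec.fst) Primrec.snd) Primrec.snd

theorem primrec_flatMap_args : Primrec fun L : List Atom => L.flatMap Atom.args :=
  Primrec.list_flatMap Primrec.id (primrec_args.comp Primrec.snd).to₂

theorem primrec_listSubst : Primrec₂ listSubst :=
  Primrec.list_getD _

theorem primrec_varBound : Primrec varBound :=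
  Primrec.list_foldr primrec_flatMap_args (Primrec.const 0)
    (Primrec.nat_max.comp (Primrec.succ.comp (Primrec.encode.comp (Primrec.fst.comp Primrec.snd)))
      (Primrec.snd.comp Primrec.snd)).to₂

theorem primrecRel_mem_vars :
    PrimrecRel fun (L : List Atom) (v : ℕ) => ∃ a ∈ L, Term.var v ∈ a.args :=
  PrimrecRel.exists_mem_comp (f := fun p : List Atom × ℕ => p.1) Primrec.fst
    (PrimrecPred.mem_list (primrec_var.comp (Primrec.snd.comp Primrec.fst))
      (primrec_args.comp Primrec.snd))

theorem primrec_sortedVars : Primrec sortedVars :=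
  (PrimrecRel.listFilter primrecRel_mem_vars.swap).comp
    (Primrec.list_range.comp primrec_varBound) Primrec.id

theorem primrec_codeFreshVar :
    Primrec fun p : ((List Atom × List Atom) × List Term) × ℕ =>
      codeFreshVar p.1.1 p.1.2 p.2 :=
  Primrec₂.natPair.comp (Primrec.encode.comp (Primrec.pair (Primrec.fst.comp Primrec.fst)
    (Primrec.list_map (primrec_sortedVars.comp (Primrec.fst.comp (Primrec.fst.comp Primrec.fst)))
      (primrec_listSubst.comp (Primrec.snd.comp (Primrec.fst.comp Primrec.fst)) Primrec.snd).to₂)))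
    Primrec.snd

theorem primrec_codeExt :
    Primrec fun p : ((List Atom × List Atom) × List Term) × ℕ => codeExt p.1.1 p.1.2 p.2 :=
  PrimrecPred.ite
    (primrecRel_mem_vars.comp (Primrec.fst.comp (Primrec.fst.comp Primrec.fst)) Primrec.snd)
    (primrec_listSubst.comp (Primrec.snd.comp Primrec.fst) Primrec.snd)
    (primrec_var.comp primrec_codeFreshVar)

theorem primrecRel_isOld : PrimrecRel fun (L : List Atom) (u : Term) => IsOld {c | c ∈ L} u := by
  have h1 : PrimrecPred fun u : Term => ∃ c, u = Term.const c :=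
    (Primrec.eq.comp (Primrec.sumCasesOn (Primrec.of_equiv (e := termEquiv))
      (Primrec.const true).to₂ (Primrec.const false).to₂) (Primrec.const true)).of_eq fun u => by
        cases u <;> simp [termEquiv]
  exact (h1.comp Primrec.snd).or <| PrimrecRel.exists_mem_comp
    (f := fun p : List Atom × Term => p.1) Primrec.fst
    (PrimrecPred.mem_list (Primrec.snd.comp Primrec.fst) (primrec_args.comp Primrec.snd))

theorem primrecPred_matches :
    PrimrecPred fun p : List Atom × Atom × Atom => Matches {c | c ∈ p.1} p.2.1 p.2.2 := by
  have ha : Primrec fun p : List Atom × Atom × Atom => p.2.1.args :=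
    primrec_args.comp (Primrec.fst.comp Primrec.snd)
  have hb : Primrec fun p : List Atom × Atom × Atom => p.2.2.args :=
    primrec_args.comp (Primrec.snd.comp Primrec.snd)
  have hl : Primrec fun p : List Atom × Atom × Atom => p.2.1.args.length :=
    Primrec.list_length.comp ha
  refine (Primrec.eq.comp (primrec_pred.comp (Primrec.fst.comp Primrec.snd))
    (primrec_pred.comp (Primrec.snd.comp Primrec.snd))).and
    ((Primrec.eq.comp hl (Primrec.list_length.comp hb)).and (PrimrecPred.and ?_ ?_))
  · refine PrimrecRel.forall_lt_comp hl ?_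
    have hi : PrimrecRel fun (q : (List Atom × Atom × Atom) × ℕ) (u : Term) =>
        IsOld {c | c ∈ q.1.1} u → q.1.2.1.args[q.2]? = q.1.2.2.args[q.2]? :=
      PrimrecPred.imp (primrecRel_isOld.comp (Primrec.fst.comp (Primrec.fst.comp Primrec.fst))
        Primrec.snd) (Primrec.eq.comp
          (Primrec.list_getElem?.comp (ha.comp (Primrec.fst.comp Primrec.fst))
            (Primrec.snd.comp Primrec.fst))
          (Primrec.list_getElem?.comp (hb.comp (Primrec.fst.comp Primrec.fst))
            (Primrec.snd.comp Primrec.fst)))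
    have ho : Primrec fun q : (List Atom × Atom × Atom) × ℕ => (q.1.2.1.args[q.2]?).toList := by
      refine (Primrec.option_casesOn (Primrec.list_getElem?.comp (ha.comp Primrec.fst)
        Primrec.snd) (Primrec.const []) (Primrec.list_cons.comp Primrec.snd
          (Primrec.const [])).to₂).of_eq fun q => ?_
      cases q.1.2.1.args[q.2]? <;> rfl
    exact (PrimrecRel.forall_mem_comp ho hi).of_eq fun q => by simp
  · refine PrimrecRel.forall_lt_comp hl (PrimrecRel.forall_lt_comp (hl.comp Primrec.fst) ?_)
    have hget : ∀ {f : List Atom × Atom × Atom → List Term}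
        {g : ((List Atom × Atom × Atom) × ℕ) × ℕ → ℕ}, Primrec f → Primrec g →
        Primrec fun q : ((List Atom × Atom × Atom) × ℕ) × ℕ => (f q.1.1)[g q]? :=
      fun hf hg => Primrec.list_getElem?.comp (hf.comp (Primrec.fst.comp Primrec.fst)) hg
    have h1 : Primrec fun q : ((List Atom × Atom × Atom) × ℕ) × ℕ => q.1.2 :=
      Primrec.snd.comp Primrec.fst
    exact PrimrecPred.imp (Primrec.eq.comp (hget ha h1) (hget ha Primrec.snd))
      (Primrec.eq.comp (hget hb h1) (hget hb Primrec.snd))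

theorem primrec_tuples : Primrec₂ tuples := by
  refine Primrec.nat_iterate Primrec.snd (Primrec.const _) ?_
  exact (Primrec.list_flatMap Primrec.snd (Primrec.list_map
    (Primrec.fst.comp (Primrec.fst.comp Primrec.fst))
    (Primrec.list_cons.comp Primrec.snd (Primrec.snd.comp Primrec.fst)).to₂).to₂).to₂

theorem primrecPred_codeFires :
    PrimrecPred fun p : (List Atom × (List Atom × List Atom)) × List Term × Atom =>
      CodeFires p.1.1 p.1.2 p.2.1 p.2.2 := by
  refine PrimrecPred.and
    (PrimrecRel.forall_mem_comp (Primrec.fst.comp (Primrec.snd.comp Primrec.fst))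
    (PrimrecPred.mem_list (primrec_subst ?_ Primrec.snd)
      (Primrec.fst.comp (Primrec.fst.comp Primrec.fst))))
    (PrimrecRel.forall_mem_comp (Primrec.fst.comp Primrec.fst) (PrimrecPred.not
      (primrecPred_matches.comp (Primrec.pair (Primrec.fst.comp (Primrec.fst.comp Primrec.fst))
        (Primrec.pair (Primrec.snd.comp (Primrec.snd.comp Primrec.fst)) Primrec.snd)))))
  exact primrec_listSubst.comp
    (Primrec.fst.comp (Primrec.snd.comp (Primrec.fst.comp Primrec.fst))) Primrec.snd

theorem primrec_succs : Primrec₂ succs := by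
  have hL : Primrec fun q : (((List (List Atom × List Atom) × List Atom) ×
      (List Atom × List Atom)) × List Term) × Atom => q.1.1.1.2 :=
    Primrec.snd.comp (Primrec.fst.comp (Primrec.fst.comp Primrec.fst))
  have hr : Primrec fun q : (((List (List Atom × List Atom) × List Atom) ×
      (List Atom × List Atom)) × List Term) × Atom => q.1.1.2 :=
    Primrec.snd.comp (Primrec.fst.comp Primrec.fst)
  have hl : Primrec fun q : (((List (List Atom × List Atom) × List Atom) ×
      (List Atom × List Atom)) × List Term) × Atom => q.1.2 :=
    Primrec.snd.comp Primrec.fst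
  have hs : Primrec fun q : (((List (List Atom × List Atom) × List Atom) ×
      (List Atom × List Atom)) × List Term) × Atom => q.2.subst (codeExt q.1.1.2 q.1.2) :=
    primrec_subst (primrec_codeExt.comp (Primrec.pair (Primrec.pair (hr.comp Primrec.fst)
      (hl.comp Primrec.fst)) Primrec.snd)).to₂ Primrec.snd
  refine Primrec.list_flatMap Primrec.fst ?_
  refine Primrec.list_flatMap (primrec_tuples.comp
    (Primrec.list_cons.comp (Primrec.const _)
      (primrec_flatMap_args.comp (Primrec.snd.comp Primrec.fst)))
    (primrec_varBound.comp (Primrec.fst.comp Primrec.snd))) ?_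
  refine Primrec.list_flatMap (Primrec.snd.comp (Primrec.snd.comp Primrec.fst)) ?_
  exact PrimrecPred.ite (primrecPred_codeFires.comp
    (Primrec.pair (Primrec.pair hL hr) (Primrec.pair hl hs)))
    (Primrec.list_cons.comp (Primrec.list_cons.comp hs hL) (Primrec.const [])) (Primrec.const [])

theorem primrec_level (Ls : List (List Atom)) : Primrec₂ fun rs n => level rs Ls n :=
  Primrec.nat_iterate Primrec.snd (Primrec.const Ls)
    (Primrec.list_flatMap Primrec.snd
      (primrec_succs.comp (Primrec.fst.comp (Primrec.fst.comp Primrec.fst)) Primrec.snd).to₂).to₂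

end Primrec

/-- No run of length `k` from `F` exists for the atomic-head rule set with code `n`. -/
def bounded (F : FactBase) (n k : ℕ) : Bool :=
  match (Encodable.decode n : Option (List (List Atom × List Atom))) with
  | none => false
  | some rs => decide ((∀ r ∈ rs, r.2.length = 1) ∧ level rs [F.toList] k = [])

theorem primrec_bounded (F : FactBase) : Primrec₂ (bounded F) := by
  have hp : PrimrecPred fun q : (ℕ × ℕ) × List (List Atom × List Atom) =>
      (∀ r ∈ q.2, r.2.length = 1) ∧ level q.2 [F.toList] q.1.2 = [] := by
    refine PrimrecPred.and (PrimrecRel.forall_mem_comp Primrec.snd ?_) (Primrec.eq.comp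
      ((primrec_level _).comp Primrec.snd (Primrec.snd.comp Primrec.fst)) (Primrec.const []))
    exact Primrec.eq.comp (Primrec.list_length.comp (Primrec.snd.comp Primrec.snd))
      (Primrec.const 1)
  refine (Primrec.option_casesOn (Primrec.decode.comp Primrec.fst) (Primrec.const false)
    (Primrec.ite hp (Primrec.const true) (Primrec.const false)).to₂).of_eq fun p => ?_
  rw [bounded]
  cases (Encodable.decode p.1 : Option (List (List Atom × List Atom))) <;> simp

theorem bounded_encode_iff {F : FactBase} {𝓡 : RuleSet} {k : ℕ} :
    bounded F (Encodable.encode 𝓡) k = true ↔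
      (∀ R ∈ 𝓡, R.IsAtomicHead) ∧ ¬ HasRun 𝓡 k F := by
  obtain ⟨ls, hcode, hls⟩ := exists_code_ruleSet 𝓡
  have hat : (∀ r ∈ ls.map Rule.code, r.2.length = 1) ↔ ∀ R ∈ 𝓡, R.IsAtomicHead := by
    simp [Rule.length_code_snd, hls, Rule.IsAtomicHead]
  rw [bounded, ← hcode, Encodable.encodek]
  simp only [decide_eq_true_iff]
  rw [hat]
  refine and_congr_right fun h => ?_
  rw [← not_iff_not, not_not, ← ne_eq, level_ne_nil_iff hls h]
  simp

/-- For atomic-head rule sets, if every fair R-derivation from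
`⟨𝓡, F⟩` is finite then there is a uniform bound `k` on the length of all
R-derivations from `⟨𝓡, F⟩`; consequently, for any fixed factbase `F`, the set of
(codes of) atomic-head rule sets whose fair R-derivations from `⟨𝓡, F⟩` are all
finite is computably enumerable. -/
theorem statement17 :
    (∀ (𝓡 : RuleSet) (F : FactBase), (∀ R ∈ 𝓡, R.IsAtomicHead) →
      (∀ D : Derivation 𝓡 F, D.IsX Variant.R → D.Fair Variant.R → D.Finite) →
      ∃ k : ℕ, ∀ D : Derivation 𝓡 F, D.IsX Variant.R → D.len ≤ (k : ℕ∞)) ∧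
    (∀ F : FactBase, ∃ f : ℕ → ℕ → Bool, Computable₂ f ∧
      ∀ 𝓡 : RuleSet,
        ((∀ R ∈ 𝓡, R.IsAtomicHead) ∧
          ∀ D : Derivation 𝓡 F, D.IsX Variant.R → D.Fair Variant.R → D.Finite) ↔
        ∃ k : ℕ, f (Encodable.encode 𝓡) k = true) := by
  refine ⟨fun 𝓡 F hat hfin => ?_, fun F => ⟨bounded F, (primrec_bounded F).to_comp, fun 𝓡 => ?_⟩⟩
  · obtain ⟨n, hn⟩ := (fair_finite_iff hat).1 hfin
    refine ⟨n, fun D hD => le_of_not_gt fun hlt => hn ?_⟩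
    exact D.fb_zero ▸ D.hasRun hD (i := 0) (by simpa using hlt.le)
  · simp only [bounded_encode_iff, exists_and_left]
    exact and_congr_right fun hat => fair_finite_iff hat

end
end ExRules
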